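/- arXiv:1809.07909 — 3 statements merged into one kernel-verified Lean document; each statement's English description precedes it below -/
import Mathlib

section
/- Assume (3G), (UB1) and (UB2). Let p, q be real numbers with 1 ≤ p ≤ q, pq > 1, q(p+1)/(q+1) < N_s and q < N_s. Let μ, ν be positive Borel measures on Ω with ∫_Ω δ(y)^s dμ(y) = ∫_Ω δ(y)^s dν(y) = 1 and ∫_Ω (𝔾[μ](x))^q·δ(x)^s dx < ∞. Then for every ε > 0 there exists t₁ > 0 such that for all ρ, τ ∈ (0, t₁) there exist measurable u, v : Ω → [0,∞] satisfying, Lebesgue-a.e. in Ω: u = 𝔾[v^p] + ρ·𝔾[μ], v = 𝔾[u^q] + τ·𝔾[ν], u ≤ ε·(𝔾[μ] + 𝔾[ν]) and v ≤ ε·(𝔾[μ] + 𝔾[ν]). -/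
open MeasureTheory Metric ENNReal

theorem rpow_lintegral_le_lintegral_rpow_div {α : Type*} [MeasurableSpace α] {m : Measure α}
    {f w : α → ℝ≥0∞} (hf : Measurable f) (hw : Measurable w) (hw0 : ∀ᵐ x ∂m, w x ≠ 0)
    (hwt : ∀ᵐ x ∂m, w x ≠ ⊤) {r : ℝ} (hr : 1 ≤ r) :
    (∫⁻ x, f x ∂m) ^ r ≤ (∫⁻ x, w x ∂m) ^ (r - 1) * ∫⁻ x, (f x / w x) ^ r * w x ∂m := by
  have hr0 : 0 < r := one_pos.trans_le hr
  have h := eLpNorm'_le_eLpNorm'_mul_rpow_measure_univ (μ := m.withDensity w)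
    (f := fun x => f x / w x) one_pos hr (hf.div hw).aestronglyMeasurable
  rw [eLpNorm'_eq_lintegral_enorm, eLpNorm'_eq_lintegral_enorm, withDensity_apply _ .univ,
    Measure.restrict_univ, lintegral_withDensity_eq_lintegral_mul _ hw (by fun_prop),
    lintegral_withDensity_eq_lintegral_mul _ hw (by fun_prop)] at h
  simp only [enorm_eq_self, ENNReal.rpow_one, div_one, Pi.mul_apply] at h
  have hcancel : ∫⁻ x, w x * (f x / w x) ∂m = ∫⁻ x, f x ∂m := by
    refine lintegral_congr_ae ?_
    filter_upwards [hw0, hwt] with x h0 ht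
    exact ENNReal.mul_div_cancel h0 ht
  rw [hcancel] at h
  calc (∫⁻ x, f x ∂m) ^ r
      ≤ ((∫⁻ x, w x * (f x / w x) ^ r ∂m) ^ (1 / r) *
          (∫⁻ x, w x ∂m) ^ (1 - 1 / r)) ^ r := ENNReal.rpow_le_rpow h hr0.le
    _ = _ := by
      rw [ENNReal.mul_rpow_of_nonneg _ _ hr0.le, ← ENNReal.rpow_mul, ← ENNReal.rpow_mul,
        one_div_mul_cancel hr0.ne', ENNReal.rpow_one, sub_mul, one_div_mul_cancel hr0.ne', one_mul,
        mul_comm]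
      simp only [mul_comm (w _)]

theorem ae_lintegral_mul_rpow_potential_le {α β : Type*} [MeasurableSpace α] [MeasurableSpace β]
    {m : Measure α} {l : Measure β} [SFinite m] [SFinite l]
    {G : α → α → ℝ≥0∞} {H : α → β → ℝ≥0∞} (hG : Measurable (Function.uncurry G))
    (hH : Measurable (Function.uncurry H))
    {w : β → ℝ≥0∞} (hw : Measurable w) (hw0 : ∀ᵐ x ∂l, w x ≠ 0) (hwt : ∀ᵐ x ∂l, w x ≠ ⊤)
    {r : ℝ} (hr : 1 ≤ r) {K : ℝ≥0∞}
    (hK : ∀ᵐ x ∂m, ∀ᵐ z ∂l, ∫⁻ y, G x y * ((H y z / w z) ^ r * w z) ∂m ≤ K * H x z) :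
    ∀ᵐ x ∂m, ∫⁻ y, G x y * (∫⁻ z, H y z ∂l) ^ r ∂m
      ≤ (∫⁻ z, w z ∂l) ^ (r - 1) * K * ∫⁻ z, H x z ∂l := by
  filter_upwards [hK] with x hx
  have hGx : Measurable (G x) := hG.of_uncurry_left
  have hH2 : Measurable fun a : α × β => H a.1 a.2 := hH
  have hmeas : Measurable fun a : α × β => (H a.1 a.2 / w a.2) ^ r * w a.2 := by fun_prop
  have hmeas' : Measurable fun a : α × β => G x a.1 * ((H a.1 a.2 / w a.2) ^ r * w a.2) := by
    fun_prop
  have hmeas'' : Measurable fun y => ∫⁻ z, (H y z / w z) ^ r * w z ∂l := hmeas.lintegral_prod_right'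
  calc ∫⁻ y, G x y * (∫⁻ z, H y z ∂l) ^ r ∂m
      ≤ ∫⁻ y, (∫⁻ z, w z ∂l) ^ (r - 1) *
          (G x y * ∫⁻ z, (H y z / w z) ^ r * w z ∂l) ∂m := by
        refine lintegral_mono fun y => ?_
        rw [mul_left_comm]
        exact mul_le_mul_right (rpow_lintegral_le_lintegral_rpow_div hH.of_uncurry_left
          hw hw0 hwt hr) _
    _ = (∫⁻ z, w z ∂l) ^ (r - 1) *
          ∫⁻ y, ∫⁻ z, G x y * ((H y z / w z) ^ r * w z) ∂l ∂m := by
        rw [lintegral_const_mul _ (by fun_prop)]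
        congr 1
        refine lintegral_congr fun y => ?_
        exact (lintegral_const_mul _ (hmeas.comp measurable_prodMk_left)).symm
    _ = (∫⁻ z, w z ∂l) ^ (r - 1) *
          ∫⁻ z, ∫⁻ y, G x y * ((H y z / w z) ^ r * w z) ∂m ∂l := by
        rw [lintegral_lintegral_swap hmeas'.aemeasurable]
    _ ≤ (∫⁻ z, w z ∂l) ^ (r - 1) * ∫⁻ z, K * H x z ∂l := by
        exact mul_le_mul_right (lintegral_mono_ae hx) _
    _ = _ := by
        rw [lintegral_const_mul _ hH.of_uncurry_left, mul_assoc]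

/-- Monotone iteration for a coupled system of integral equations below a supersolution. -/
theorem exists_solution_of_ae_supersolution {α : Type*} [MeasurableSpace α] {m : Measure α}
    [SFinite m] {G : α → α → ℝ≥0∞} (hG : Measurable (Function.uncurry G)) {p q : ℝ}
    (hp : 0 < p) (hq : 0 < q) {f g U V : α → ℝ≥0∞} (hf : Measurable f) (hg : Measurable g)
    (hU : ∀ᵐ x ∂m, (∫⁻ y, G x y * V y ^ p ∂m) + f x ≤ U x)
    (hV : ∀ᵐ x ∂m, (∫⁻ y, G x y * U y ^ q ∂m) + g x ≤ V x) :
    ∃ u v : α → ℝ≥0∞, Measurable u ∧ Measurable v ∧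
      (∀ x, u x = (∫⁻ y, G x y * v y ^ p ∂m) + f x) ∧
      (∀ x, v x = (∫⁻ y, G x y * u y ^ q ∂m) + g x) ∧
      u ≤ᵐ[m] U ∧ v ≤ᵐ[m] V := by
  let T (r : ℝ) (h w : α → ℝ≥0∞) : α → ℝ≥0∞ := fun x => (∫⁻ y, G x y * w y ^ r ∂m) + h x
  have hT_mono {r : ℝ} (hr : 0 < r) {h w w' : α → ℝ≥0∞} (hw : w ≤ w') : T r h w ≤ T r h w' :=
    fun x => by
      dsimp only [T]
      gcongr
      exact hw _
  have hT_meas {r : ℝ} {h w : α → ℝ≥0∞} (hh : Measurable h) (hw : Measurable w) :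
      Measurable (T r h w) := by
    have hG' : Measurable fun a : α × α => G a.1 a.2 := hG
    have : Measurable fun a : α × α => G a.1 a.2 * w a.2 ^ r := by fun_prop
    exact this.lintegral_prod_right'.add hh
  have hT_iSup {r : ℝ} (hr : 0 < r) {h : α → ℝ≥0∞} {w : ℕ → α → ℝ≥0∞}
      (hw : ∀ n, Measurable (w n)) (hmono : Monotone w) :
      T r h (⨆ n, w n) = ⨆ n, T r h (w n) := by
    funext x
    have hGx : Measurable (G x) := hG.of_uncurry_left
    simp only [T, iSup_apply]
    rw [← ENNReal.iSup_add, ← lintegral_iSup (fun n => by have := hw n; fun_prop)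
      fun i j hij y => by gcongr; exact hmono hij y]
    congr 1
    refine lintegral_congr fun y => ?_
    rw [← ENNReal.mul_iSup]
    congr 1
    exact (ENNReal.orderIsoRpow r hr).map_iSup _
  let S (a : (α → ℝ≥0∞) × (α → ℝ≥0∞)) : (α → ℝ≥0∞) × (α → ℝ≥0∞) := (T p f a.2, T q g a.1)
  have hS : Monotone S := fun a b hab => ⟨hT_mono hp hab.2, hT_mono hq hab.1⟩
  let a (n : ℕ) := S^[n] ⊥
  have ha_succ (n : ℕ) : a (n + 1) = S (a n) := Function.iterate_succ_apply' _ _ _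
  have ha_mono : Monotone a := hS.monotone_iterate_of_le_map bot_le
  have ha_meas (n : ℕ) : Measurable (a n).1 ∧ Measurable (a n).2 := by
    induction n with
    | zero => exact ⟨measurable_const, measurable_const⟩
    | succ n ih =>
      rw [ha_succ]
      exact ⟨hT_meas hf ih.2, hT_meas hg ih.1⟩
  have ha_le (n : ℕ) : (a n).1 ≤ᵐ[m] U ∧ (a n).2 ≤ᵐ[m] V := by
    induction n with
    | zero => exact ⟨.of_forall fun _ => bot_le, .of_forall fun _ => bot_le⟩
    | succ n ih =>
      rw [ha_succ]
      constructor
      · filter_upwards [hU] with x hx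
        refine le_trans (add_le_add_left (lintegral_mono_ae ?_) _) hx
        filter_upwards [ih.2] with y hy
        gcongr
      · filter_upwards [hV] with x hx
        refine le_trans (add_le_add_left (lintegral_mono_ae ?_) _) hx
        filter_upwards [ih.1] with y hy
        gcongr
  have ha_iSup {b : ℕ → α → ℝ≥0∞} (hb : Monotone b) : ⨆ n, b (n + 1) = ⨆ n, b n :=
    hb.iSup_nat_add 1
  have h1 : Monotone fun n => (a n).1 := fun i j hij => (ha_mono hij).1
  have h2 : Monotone fun n => (a n).2 := fun i j hij => (ha_mono hij).2
  refine ⟨⨆ n, (a n).1, ⨆ n, (a n).2, ?_, ?_, ?_, ?_, ?_, ?_⟩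
  · simpa only [← iSup_apply] using Measurable.iSup fun n => (ha_meas n).1
  · simpa only [← iSup_apply] using Measurable.iSup fun n => (ha_meas n).2
  · refine congrFun (?_ : _ = T p f _)
    rw [hT_iSup hp (fun n => (ha_meas n).2) h2, ← ha_iSup h1]
    simp only [ha_succ, S]
  · refine congrFun (?_ : _ = T q g _)
    rw [hT_iSup hq (fun n => (ha_meas n).1) h1, ← ha_iSup h2]
    simp only [ha_succ, S]
  · filter_upwards [ae_all_iff.2 fun n => (ha_le n).1] with x hx
    rw [iSup_apply]
    exact iSup_le hx
  · filter_upwards [ae_all_iff.2 fun n => (ha_le n).2] with x hx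
    rw [iSup_apply]
    exact iSup_le hx

theorem setLIntegral_ball_norm_rpow_lt_top {E : Type*} [NormedAddCommGroup E] [NormedSpace ℝ E]
    [FiniteDimensional ℝ E] [Nontrivial E] [MeasurableSpace E] [BorelSpace E] (m : Measure E)
    [m.IsAddHaarMeasure] {t : ℝ} (ht : -(Module.finrank ℝ E : ℝ) < t) (R : ℝ) :
    ∫⁻ x in ball (0 : E) R, ENNReal.ofReal (‖x‖ ^ t) ∂m < ⊤ := by
  rcases le_or_gt R 0 with hR | hR
  · simp [ball_eq_empty.2 hR]
  have hpos : 0 < Module.finrank ℝ E := Module.finrank_pos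
  have h : IntegrableOn (fun x : E => ‖x‖ ^ t) (ball 0 R) m := by
    refine (integrableOn_fun_norm_addHaar m (f := fun a => a ^ t)).2 ?_
    have h' : IntegrableOn (fun y : ℝ => y ^ (((Module.finrank ℝ E - 1 : ℕ) : ℝ) + t))
        (Set.Ioo 0 R) := by
      refine (intervalIntegral.integrableOn_Ioo_rpow_iff hR).2 ?_
      rw [Nat.cast_sub hpos]
      push_cast
      linarith
    refine h'.congr_fun (fun y hy => ?_) measurableSet_Ioo
    simp only [smul_eq_mul]
    rw [Real.rpow_add hy.1, Real.rpow_natCast]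
  exact h.lintegral_lt_top

theorem setLIntegral_dist_rpow_le {E : Type*} [NormedAddCommGroup E] [NormedSpace ℝ E]
    [FiniteDimensional ℝ E] [MeasurableSpace E] [BorelSpace E] (m : Measure E)
    [m.IsAddHaarMeasure] (t : ℝ) {S : Set E} {R : ℝ} {z : E} (hS : S ⊆ ball z R) :
    ∫⁻ y in S, ENNReal.ofReal (dist y z ^ t) ∂m
      ≤ ∫⁻ y in ball (0 : E) R, ENNReal.ofReal (‖y‖ ^ t) ∂m := by
  refine (lintegral_mono_set hS).trans_eq ?_
  rw [← lintegral_indicator measurableSet_ball, ← lintegral_indicator measurableSet_ball,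
    ← lintegral_sub_right_eq_self (μ := m) ((ball 0 R).indicator _) z]
  refine lintegral_congr fun y => ?_
  simp [Set.indicator, dist_eq_norm]

theorem rpow_mul_rpow_mul_rpow_le {X Y Z a b : ℝ} (hX : 0 < X) (hY : 0 < Y) (hZ : 0 ≤ Z)
    (hZXY : Z ≤ X + Y) (ha : 0 ≤ a) (hb : 0 ≤ b) :
    Z ^ a * X ^ (-a) * Y ^ (-a) * Y ^ (-b) ≤ 2 ^ a * (X ^ (-(a + b)) + Y ^ (-(a + b))) := by
  have hX' := Real.rpow_nonneg hX.le (-(a + b))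
  have hY' := Real.rpow_nonneg hY.le (-(a + b))
  have key {W V : ℝ} (hW : 0 < W) (hV : 0 < V) (hZW : Z ≤ 2 * W) :
      Z ^ a * W ^ (-a) * V ^ (-a) ≤ 2 ^ a * V ^ (-a) := by
    have : Z ^ a ≤ 2 ^ a * W ^ a := by
      rw [← Real.mul_rpow two_pos.le hW.le]
      exact Real.rpow_le_rpow hZ hZW ha
    have h1 : W ^ a * W ^ (-a) = 1 := by
      rw [← Real.rpow_add hW, add_neg_cancel, Real.rpow_zero]
    gcongr
    calc Z ^ a * W ^ (-a) ≤ 2 ^ a * W ^ a * W ^ (-a) := by gcongr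
      _ = 2 ^ a := by rw [mul_assoc, h1, mul_one]
  rcases le_total X Y with h | h
  · calc Z ^ a * X ^ (-a) * Y ^ (-a) * Y ^ (-b)
        = Z ^ a * Y ^ (-a) * X ^ (-a) * Y ^ (-b) := by ring
      _ ≤ 2 ^ a * X ^ (-a) * X ^ (-b) := by
        have h1 := key hY hX (by linarith)
        have h2 : Y ^ (-b) ≤ X ^ (-b) :=
          Real.rpow_le_rpow_of_nonpos hX h (by linarith)
        gcongr
      _ = 2 ^ a * X ^ (-(a + b)) := by
        rw [mul_assoc, ← Real.rpow_add hX, neg_add]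
      _ ≤ _ := by gcongr; linarith
  · calc Z ^ a * X ^ (-a) * Y ^ (-a) * Y ^ (-b)
      _ ≤ 2 ^ a * Y ^ (-a) * Y ^ (-b) := by
        have h1 := key hX hY (by linarith)
        gcongr
      _ = 2 ^ a * Y ^ (-(a + b)) := by
        rw [mul_assoc, ← Real.rpow_add hY, neg_add]
      _ ≤ _ := by gcongr; linarith

theorem sFinite_of_lintegral_ne_top {α : Type*} [MeasurableSpace α] {m : Measure α}
    {w : α → ℝ≥0∞} (hw : Measurable w) (hw0 : ∀ᵐ x ∂m, w x ≠ 0) (hwt : ∫⁻ x, w x ∂m ≠ ⊤) :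
    SFinite m := by
  have : IsFiniteMeasure (m.withDensity w) := isFiniteMeasure_withDensity hwt
  rw [← withDensity_inv_same hw hw0 ((ae_lt_top hw hwt).mono fun _ => ne_of_lt)]
  infer_instance

theorem mul_div_rpow_mul_le {gxy gyz gxz w : ℝ≥0∞} {X Y Z a b r C₁ C₂ : ℝ}
    (hX : 0 < X) (hY : 0 < Y) (hZ : 0 ≤ Z) (hZXY : Z ≤ X + Y) (ha : 0 ≤ a) (hb : 0 ≤ b)
    (hr : 1 ≤ r) (hC₁ : 0 ≤ C₁) (hC₂ : 0 ≤ C₂) (hw0 : w ≠ 0) (hwt : w ≠ ⊤)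
    (h3G : gxy * gyz ≤ ENNReal.ofReal C₁ * gxz * ENNReal.ofReal (Z ^ a) *
      ENNReal.ofReal (X ^ (-a)) * ENNReal.ofReal (Y ^ (-a)))
    (hUB : gyz ≤ ENNReal.ofReal (C₂ * Y ^ (-b)) * w) :
    gxy * ((gyz / w) ^ r * w) ≤ ENNReal.ofReal (C₁ * C₂ ^ (r - 1) * 2 ^ a) *
      (ENNReal.ofReal (X ^ (-(a + b * (r - 1)))) + ENNReal.ofReal (Y ^ (-(a + b * (r - 1))))) *
      gxz := by
  have hr1 : 0 ≤ r - 1 := by linarith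
  have hYb := Real.rpow_nonneg hY.le (-b)
  have hsplit : (gyz / w) ^ r * w = gyz * (gyz / w) ^ (r - 1) := by
    conv_lhs => rw [show r = (r - 1) + 1 by ring]
    rw [ENNReal.rpow_add_of_nonneg _ _ hr1 zero_le_one, ENNReal.rpow_one, mul_assoc,
      ENNReal.div_mul_cancel hw0 hwt, mul_comm]
  have hpow : (gyz / w) ^ (r - 1) ≤ ENNReal.ofReal (C₂ ^ (r - 1) * Y ^ (-(b * (r - 1)))) := by
    calc (gyz / w) ^ (r - 1) ≤ ENNReal.ofReal (C₂ * Y ^ (-b)) ^ (r - 1) :=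
          ENNReal.rpow_le_rpow (ENNReal.div_le_of_le_mul hUB) hr1
      _ = _ := by
          rw [ENNReal.ofReal_rpow_of_nonneg (by positivity) hr1, Real.mul_rpow hC₂ hYb,
            ← Real.rpow_mul hY.le, neg_mul]
  calc gxy * ((gyz / w) ^ r * w) = gxy * gyz * (gyz / w) ^ (r - 1) := by
        rw [hsplit, mul_assoc]
    _ ≤ ENNReal.ofReal C₁ * gxz * ENNReal.ofReal (Z ^ a) *
        ENNReal.ofReal (X ^ (-a)) * ENNReal.ofReal (Y ^ (-a)) *
        ENNReal.ofReal (C₂ ^ (r - 1) * Y ^ (-(b * (r - 1)))) := mul_le_mul' h3G hpow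
    _ = ENNReal.ofReal (C₁ * C₂ ^ (r - 1) *
          (Z ^ a * X ^ (-a) * Y ^ (-a) * Y ^ (-(b * (r - 1))))) * gxz := by
        have e : C₁ * C₂ ^ (r - 1) * (Z ^ a * X ^ (-a) * Y ^ (-a) * Y ^ (-(b * (r - 1))))
          = C₁ * (Z ^ a * (X ^ (-a) * (Y ^ (-a) * (C₂ ^ (r - 1) * Y ^ (-(b * (r - 1))))))) := by
          ring
        have hc : 0 ≤ C₂ ^ (r - 1) * Y ^ (-(b * (r - 1))) := by positivity
        rw [e]
        generalize C₂ ^ (r - 1) * Y ^ (-(b * (r - 1))) = c at hc ⊢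
        rw [ENNReal.ofReal_mul hC₁, ENNReal.ofReal_mul (by positivity),
          ENNReal.ofReal_mul (by positivity), ENNReal.ofReal_mul (by positivity)]
        ring
    _ ≤ ENNReal.ofReal (C₁ * C₂ ^ (r - 1) *
          (2 ^ a * (X ^ (-(a + b * (r - 1))) + Y ^ (-(a + b * (r - 1)))))) * gxz := by
        refine mul_le_mul_left (ENNReal.ofReal_le_ofReal (mul_le_mul_of_nonneg_left ?_
          (by positivity))) _
        exact rpow_mul_rpow_mul_rpow_le hX hY hZ hZXY ha (mul_nonneg hb hr1)
    _ = _ := by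
        rw [← mul_assoc, ENNReal.ofReal_mul (by positivity),
          ENNReal.ofReal_add (by positivity) (by positivity)]

theorem infDist_compl_pos {E : Type*} [NormedAddCommGroup E] [NormedSpace ℝ E] [Nontrivial E]
    {Ω : Set E} (hΩ : IsOpen Ω) (hΩb : Bornology.IsBounded Ω) {x : E} (hx : x ∈ Ω) :
    0 < infDist x Ωᶜ := by
  refine (hΩ.isClosed_compl.notMem_iff_infDist_pos ?_).1 (Set.notMem_compl_iff.2 hx)
  rw [Set.nonempty_compl]
  rintro rfl
  exact NormedSpace.unbounded_univ ℝ E hΩb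

theorem exists_pos_mul_rpow_le {q : ℝ} (hq : 1 < q) {c k ε : ℝ} (hk : 0 < k)
    (hε : 0 < ε) : ∃ η : ℝ, 0 < η ∧ η ≤ 1 ∧ η ≤ ε ∧ k * η ≤ ε ∧ (k * η) ^ q * c ≤ η / 2 := by
  have h1 : Filter.Tendsto (fun η : ℝ => k ^ q * c * η ^ (q - 1)) (nhdsWithin 0 (Set.Ioi 0))
      (nhds 0) := by
    have := ((Real.continuousAt_rpow_const 0 (q - 1) (.inr (by linarith))).tendsto.const_mul
      (k ^ q * c)).mono_left (nhdsWithin_le_nhds (s := Set.Ioi 0))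
    simpa [Real.zero_rpow (by linarith : q - 1 ≠ 0)] using this
  have h2 : Set.Ioo (0 : ℝ) (min 1 (min ε (ε / k))) ∈ nhdsWithin (0 : ℝ) (Set.Ioi 0) :=
    Ioo_mem_nhdsGT (by positivity)
  obtain ⟨η, hη, hη0, hηlt⟩ :=
    ((h1.eventually (gt_mem_nhds (by norm_num : (0 : ℝ) < 1 / 2))).and h2).exists
  simp only [lt_min_iff] at hηlt
  refine ⟨η, hη0, hηlt.1.le, hηlt.2.1.le, ?_, ?_⟩
  · rw [mul_comm]
    exact ((lt_div_iff₀ hk).1 hηlt.2.2).le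
  · calc (k * η) ^ q * c = k ^ q * c * η ^ (q - 1) * η := by
          rw [Real.mul_rpow hk.le hη0.le, mul_assoc (k ^ q * c), ← Real.rpow_add_one hη0.ne',
            sub_add_cancel]
          ring
      _ ≤ 1 / 2 * η := by gcongr
      _ = η / 2 := by ring

theorem ae_lintegral_mul_rpow_const_mul_add_le {α : Type*} [MeasurableSpace α] {m : Measure α}
    {G : α → α → ℝ≥0∞} {W h : α → ℝ≥0∞} {r c k k' t : ℝ} (hr : 0 ≤ r) (hc : 0 ≤ c) (hk : 0 ≤ k)
    (ht : 0 ≤ t) (hW : ∀ᵐ x ∂m, ∫⁻ y, G x y * W y ^ r ∂m ≤ ENNReal.ofReal c * W x)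
    (hh : ∀ x, h x ≤ W x) (hkk : k ^ r * c + t ≤ k') :
    ∀ᵐ x ∂m, (∫⁻ y, G x y * (ENNReal.ofReal k * W y) ^ r ∂m) + ENNReal.ofReal t * h x
      ≤ ENNReal.ofReal k' * W x := by
  filter_upwards [hW] with x hx
  have hpull : ∫⁻ y, G x y * (ENNReal.ofReal k * W y) ^ r ∂m
      = ENNReal.ofReal (k ^ r) * ∫⁻ y, G x y * W y ^ r ∂m := by
    rw [← lintegral_const_mul' _ _ ENNReal.ofReal_ne_top]
    refine lintegral_congr fun y => ?_
    rw [ENNReal.mul_rpow_of_nonneg _ _ hr, ENNReal.ofReal_rpow_of_nonneg hk hr, mul_left_comm]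
  calc (∫⁻ y, G x y * (ENNReal.ofReal k * W y) ^ r ∂m) + ENNReal.ofReal t * h x
      ≤ ENNReal.ofReal (k ^ r) * (ENNReal.ofReal c * W x) + ENNReal.ofReal t * W x := by
        rw [hpull]
        gcongr
        exact hh x
    _ = ENNReal.ofReal (k ^ r * c + t) * W x := by
        rw [ENNReal.ofReal_add (by positivity) ht, ENNReal.ofReal_mul (by positivity)]
        ring
    _ ≤ ENNReal.ofReal k' * W x := by gcongr

theorem exists_lintegral_mul_rpow_potential_le
    {N : ℕ} (hN : 0 < N) {s : ℝ} (hs0 : 0 < s) (hNs : 2 * s < (N : ℝ))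
    {Ω : Set (EuclideanSpace ℝ (Fin N))} (hΩopen : IsOpen Ω)
    (hΩbd : Bornology.IsBounded Ω)
    {G : EuclideanSpace ℝ (Fin N) → EuclideanSpace ℝ (Fin N) → ℝ≥0∞}
    (hGmeas : Measurable (Function.uncurry G))
    {C₁ : ℝ} (hC₁ : 0 < C₁)
    (h3G : ∀ x ∈ Ω, ∀ y ∈ Ω, ∀ z ∈ Ω, x ≠ y → y ≠ z → x ≠ z →
      G x y * G y z ≤ ENNReal.ofReal C₁ * G x z *
        ENNReal.ofReal (dist x z ^ ((N : ℝ) - 2 * s)) *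
        ENNReal.ofReal (dist x y ^ (2 * s - (N : ℝ))) *
        ENNReal.ofReal (dist y z ^ (2 * s - (N : ℝ))))
    {C₂ : ℝ} (hC₂ : 0 < C₂)
    (hUB1 : ∀ x ∈ Ω, ∀ y ∈ Ω, x ≠ y →
      G x y ≤ ENNReal.ofReal (C₂ * infDist y Ωᶜ ^ s * dist x y ^ (s - (N : ℝ))))
    {l : Measure (EuclideanSpace ℝ (Fin N))} [SFinite l] (hl : ∀ᵐ z ∂l, z ∈ Ω)
    (hlfin : ∫⁻ z, ENNReal.ofReal (infDist z Ωᶜ ^ s) ∂l ≠ ⊤)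
    {r : ℝ} (hr : 1 ≤ r) (hrN : r < ((N : ℝ) + s) / ((N : ℝ) - s)) :
    ∃ C : ℝ, 0 ≤ C ∧ ∀ᵐ x ∂(volume.restrict Ω),
      ∫⁻ y in Ω, G x y * (∫⁻ z, G y z ∂l) ^ r ≤ ENNReal.ofReal C * ∫⁻ z, G x z ∂l := by
  have : Nonempty (Fin N) := ⟨⟨0, hN⟩⟩
  obtain ⟨R, hR⟩ := Metric.isBounded_iff.1 hΩbd
  have hball {z} (hz : z ∈ Ω) : Ω ⊆ ball z (R + 1) := fun y hy =>
    mem_ball.2 ((hR hy hz).trans_lt (lt_add_one R))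
  have hNs' : 0 < (N : ℝ) - s := by linarith
  have hexp : (r - 1) * (N - s) < 2 * s := by
    rw [lt_div_iff₀ hNs'] at hrN
    linarith
  set t : ℝ := -((N - 2 * s) + (N - s) * (r - 1)) with ht
  set I : ℝ≥0∞ := ∫⁻ y in ball (0 : EuclideanSpace ℝ (Fin N)) (R + 1),
    ENNReal.ofReal (‖y‖ ^ t)
  have hItop : I < ⊤ := setLIntegral_ball_norm_rpow_lt_top volume
    (by rw [finrank_euclideanSpace_fin, ht]; linarith) _
  set k : ℝ≥0∞ := ENNReal.ofReal (C₁ * C₂ ^ (r - 1) * 2 ^ ((N : ℝ) - 2 * s))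
  have hdmeas : Measurable fun z : EuclideanSpace ℝ (Fin N) =>
      ENNReal.ofReal (infDist z Ωᶜ ^ s) := by
    have : Measurable fun z : EuclideanSpace ℝ (Fin N) => infDist z Ωᶜ := measurable_infDist
    fun_prop
  have hd0 {z} (hz : z ∈ Ω) : ENNReal.ofReal (infDist z Ωᶜ ^ s) ≠ 0 := by
    have := infDist_compl_pos hΩopen hΩbd hz
    exact (ENNReal.ofReal_pos.2 (by positivity)).ne'
  have hne : ∀ᵐ x ∂(volume.restrict Ω), ∀ᵐ z ∂l, x ≠ z := by
    rw [Measure.ae_ae_comm measurableSet_diagonal.compl]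
    exact .of_forall fun z => ae_restrict_of_ae (Measure.ae_ne volume z)
  have hK : ∀ᵐ x ∂(volume.restrict Ω), ∀ᵐ z ∂l,
      ∫⁻ y in Ω, G x y * ((G y z / ENNReal.ofReal (infDist z Ωᶜ ^ s)) ^ r *
        ENNReal.ofReal (infDist z Ωᶜ ^ s)) ≤ k * (I + I) * G x z := by
    filter_upwards [hne, ae_restrict_mem hΩopen.measurableSet] with x hx hxΩ
    filter_upwards [hx, hl] with z hxz hzΩ
    have hI_le {w} (hw : w ∈ Ω) : ∫⁻ y in Ω, ENNReal.ofReal (dist y w ^ t) ≤ I :=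
      setLIntegral_dist_rpow_le volume t (hball hw)
    calc ∫⁻ y in Ω, G x y * ((G y z / ENNReal.ofReal (infDist z Ωᶜ ^ s)) ^ r *
          ENNReal.ofReal (infDist z Ωᶜ ^ s))
        ≤ ∫⁻ y in Ω, k * (ENNReal.ofReal (dist y x ^ t) + ENNReal.ofReal (dist y z ^ t)) *
            G x z := by
          refine lintegral_mono_ae ?_
          filter_upwards [ae_restrict_mem hΩopen.measurableSet,
            ae_restrict_of_ae (Measure.ae_ne volume x),
            ae_restrict_of_ae (Measure.ae_ne volume z)] with y hyΩ hyx hyz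
          have h3 := h3G x hxΩ y hyΩ z hzΩ hyx.symm hyz hxz
          rw [← neg_sub (N : ℝ) (2 * s)] at h3
          rw [dist_comm y x]
          refine mul_div_rpow_mul_le (dist_pos.2 hyx.symm) (dist_pos.2 hyz) dist_nonneg
            (dist_triangle x y z) (by linarith) hNs'.le hr hC₁.le hC₂.le (hd0 hzΩ)
            ENNReal.ofReal_ne_top h3 ?_
          rw [neg_sub, ← ENNReal.ofReal_mul (by positivity)]
          convert hUB1 y hyΩ z hzΩ hyz using 2
          ring
      _ = k * ((∫⁻ y in Ω, ENNReal.ofReal (dist y x ^ t)) +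
            ∫⁻ y in Ω, ENNReal.ofReal (dist y z ^ t)) * G x z := by
          rw [lintegral_mul_const _ (by fun_prop), lintegral_const_mul _ (by fun_prop),
            lintegral_add_left (by fun_prop)]
      _ ≤ k * (I + I) * G x z := by
          gcongr
          exacts [hI_le hxΩ, hI_le hzΩ]
  have hC := ae_lintegral_mul_rpow_potential_le hGmeas hGmeas hdmeas
    (hl.mono fun z hz => hd0 hz) (.of_forall fun _ => ENNReal.ofReal_ne_top) hr hK
  have hCtop : (∫⁻ z, ENNReal.ofReal (infDist z Ωᶜ ^ s) ∂l) ^ (r - 1) * (k * (I + I)) ≠ ⊤ :=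
    ENNReal.mul_ne_top (ENNReal.rpow_ne_top_of_nonneg (by linarith) hlfin)
      (ENNReal.mul_ne_top ENNReal.ofReal_ne_top (ENNReal.add_ne_top.2 ⟨hItop.ne, hItop.ne⟩))
  refine ⟨((∫⁻ z, ENNReal.ofReal (infDist z Ωᶜ ^ s) ∂l) ^ (r - 1) * (k * (I + I))).toReal,
    ENNReal.toReal_nonneg, ?_⟩
  rwa [ENNReal.ofReal_toReal hCtop]

/-- Under (3G), (UB1), (UB2), for `1 ≤ p ≤ q`, `pq > 1`,
`q(p+1)/(q+1) < N_s`, `q < N_s`, with normalized `μ,ν` and `𝔾[μ] ∈ L^q(Ω,δ^s)`: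
for every `ε > 0` there is `t₁ > 0` such that for `ρ,τ ∈ (0,t₁)` the system with data
`(ρμ,τν)` has a solution `(u,v)` with `u,v ≤ ε·(𝔾[μ]+𝔾[ν])` a.e. in `Ω`. -/
theorem stmt_8
    (N : ℕ) (hN : 0 < N) (s : ℝ) (hs0 : 0 < s) (hs1 : s < 1) (hNs : 2 * s < (N : ℝ))
    (Ω : Set (EuclideanSpace ℝ (Fin N))) (hΩopen : IsOpen Ω) (hΩne : Ω.Nonempty)
    (hΩbd : Bornology.IsBounded Ω)
    (G : EuclideanSpace ℝ (Fin N) → EuclideanSpace ℝ (Fin N) → ℝ≥0∞)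
    (hGmeas : Measurable (Function.uncurry G))
    (C₁ : ℝ) (hC₁ : 0 < C₁)
    (h3G : ∀ x ∈ Ω, ∀ y ∈ Ω, ∀ z ∈ Ω, x ≠ y → y ≠ z → x ≠ z →
      G x y * G y z ≤ ENNReal.ofReal C₁ * G x z *
        ENNReal.ofReal (dist x z ^ ((N : ℝ) - 2 * s)) *
        ENNReal.ofReal (dist x y ^ (2 * s - (N : ℝ))) *
        ENNReal.ofReal (dist y z ^ (2 * s - (N : ℝ))))
    (C₂ : ℝ) (hC₂ : 0 < C₂)
    (hUB1 : ∀ x ∈ Ω, ∀ y ∈ Ω, x ≠ y →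
      G x y ≤ ENNReal.ofReal (C₂ * infDist y Ωᶜ ^ s * dist x y ^ (s - (N : ℝ))))
    (C₃ : ℝ) (hC₃ : 0 < C₃)
    (hUB2 : ∀ x ∈ Ω, ∀ y ∈ Ω, x ≠ y →
      G x y ≤ ENNReal.ofReal (C₃ * dist x y ^ (2 * s - (N : ℝ))))
    (p q : ℝ) (hp : 1 ≤ p) (hpq : p ≤ q) (hpq1 : 1 < p * q)
    (hqNs : q * (p + 1) / (q + 1) < ((N : ℝ) + s) / ((N : ℝ) - s))
    (hq : q < ((N : ℝ) + s) / ((N : ℝ) - s))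
    (μ ν : Measure (EuclideanSpace ℝ (Fin N)))
    (hμ : (∫⁻ y in Ω, ENNReal.ofReal (infDist y Ωᶜ ^ s) ∂μ) = 1)
    (hν : (∫⁻ y in Ω, ENNReal.ofReal (infDist y Ωᶜ ^ s) ∂ν) = 1)
    (hGμq : (∫⁻ x in Ω, (∫⁻ y in Ω, G x y ∂μ) ^ q *
      ENNReal.ofReal (infDist x Ωᶜ ^ s)) < ⊤) :
    ∀ ε : ℝ, 0 < ε →
      ∃ t₁ : ℝ, 0 < t₁ ∧
        ∀ ρ τ : ℝ, 0 < ρ → ρ < t₁ → 0 < τ → τ < t₁ →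
          ∃ u v : EuclideanSpace ℝ (Fin N) → ℝ≥0∞,
            Measurable u ∧ Measurable v ∧
            (∀ᵐ x ∂(volume.restrict Ω),
              u x = (∫⁻ y in Ω, G x y * v y ^ p) +
                ENNReal.ofReal ρ * ∫⁻ y in Ω, G x y ∂μ) ∧
            (∀ᵐ x ∂(volume.restrict Ω),
              v x = (∫⁻ y in Ω, G x y * u y ^ q) +
                ENNReal.ofReal τ * ∫⁻ y in Ω, G x y ∂ν) ∧
            (∀ᵐ x ∂(volume.restrict Ω),
              u x ≤ ENNReal.ofReal ε *
                ((∫⁻ y in Ω, G x y ∂μ) + ∫⁻ y in Ω, G x y ∂ν)) ∧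
            (∀ᵐ x ∂(volume.restrict Ω),
              v x ≤ ENNReal.ofReal ε *
                ((∫⁻ y in Ω, G x y ∂μ) + ∫⁻ y in Ω, G x y ∂ν)) := by
  intro ε hε
  have : Nonempty (Fin N) := ⟨⟨0, hN⟩⟩
  have hdmeas : Measurable fun z : EuclideanSpace ℝ (Fin N) =>
      ENNReal.ofReal (infDist z Ωᶜ ^ s) := by
    have : Measurable fun z : EuclideanSpace ℝ (Fin N) => infDist z Ωᶜ := measurable_infDist
    fun_prop
  have hmem (m : Measure (EuclideanSpace ℝ (Fin N))) : ∀ᵐ z ∂(m.restrict Ω), z ∈ Ω :=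
    ae_restrict_mem hΩopen.measurableSet
  have hsfin {m : Measure (EuclideanSpace ℝ (Fin N))}
      (hm : ∫⁻ z in Ω, ENNReal.ofReal (infDist z Ωᶜ ^ s) ∂m = 1) : SFinite (m.restrict Ω) := by
    refine sFinite_of_lintegral_ne_top hdmeas ?_ (hm.trans_ne ENNReal.one_ne_top)
    filter_upwards [hmem m] with z hz
    have := infDist_compl_pos hΩopen hΩbd hz
    exact (ENNReal.ofReal_pos.2 (by positivity)).ne'
  have := hsfin hμ
  have := hsfin hν
  have hq1 : 1 < q := by nlinarith
  let W (x : EuclideanSpace ℝ (Fin N)) : ℝ≥0∞ := ∫⁻ y, G x y ∂(μ.restrict Ω + ν.restrict Ω)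
  have hW (x) : W x = (∫⁻ y in Ω, G x y ∂μ) + ∫⁻ y in Ω, G x y ∂ν :=
    lintegral_add_measure _ _ _
  have hpot {r : ℝ} (hr : 1 ≤ r) (hrN : r < ((N : ℝ) + s) / ((N : ℝ) - s)) :=
    exists_lintegral_mul_rpow_potential_le hN hs0 hNs hΩopen hΩbd hGmeas hC₁ h3G hC₂ hUB1
      (ae_add_measure_iff.2 ⟨hmem μ, hmem ν⟩)
      (by rw [lintegral_add_measure, hμ, hν]; exact ENNReal.add_ne_top.2 (by simp)) hr hrN
  obtain ⟨a, ha, hap⟩ := hpot hp (hpq.trans_lt hq)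
  obtain ⟨b, hb, hbq⟩ := hpot hq1.le hq
  obtain ⟨η, hη0, hη1, hηε, hkη, hηq⟩ :=
    exists_pos_mul_rpow_le hq1 (c := b) (show 0 < a + 1 by positivity) hε
  refine ⟨η / 2, by positivity, fun ρ τ hρ hρη hτ hτη => ?_⟩
  have hηp : η ^ p ≤ η := by
    simpa using Real.rpow_le_rpow_of_exponent_ge hη0 hη1 hp
  have hU := ae_lintegral_mul_rpow_const_mul_add_le (W := W) (by linarith) ha hη0.le hρ.le hap
    (fun x => le_self_add.trans_eq (hW x).symm) (k' := (a + 1) * η) (by nlinarith)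
  have hV := ae_lintegral_mul_rpow_const_mul_add_le (W := W) (by linarith) hb
    (show 0 ≤ (a + 1) * η by positivity) hτ.le hbq
    (fun x => le_add_self.trans_eq (hW x).symm) (k' := η) (by linarith)
  have hmeasW {m : Measure (EuclideanSpace ℝ (Fin N))} [SFinite (m.restrict Ω)] (t : ℝ) :
      Measurable fun x => ENNReal.ofReal t * ∫⁻ y in Ω, G x y ∂m :=
    hGmeas.lintegral_prod_right.const_mul _
  obtain ⟨u, v, hu, hv, huv, hvu, huU, hvV⟩ := exists_solution_of_ae_supersolution hGmeas
    (one_pos.trans_le hp) (one_pos.trans hq1) (hmeasW ρ) (hmeasW τ) hU hV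
  refine ⟨u, v, hu, hv, .of_forall huv, .of_forall hvu, ?_, ?_⟩
  · filter_upwards [huU] with x hx
    rw [← hW]
    exact hx.trans (by gcongr)
  · filter_upwards [hvV] with x hx
    rw [← hW]
    exact hx.trans (by gcongr)
end

section
/- Let p > 1 be real, let θ ∈ (2, p+1), and let M > 0. Then there exists T > 0, depending on p, M and θ, such that H_p(r,t) ≤ (1/θ)·h_p(r,t)·t for all r ∈ [0,M] and all t ≥ T. -/
/-- `h_p(r,t) = (r + t⁺)^p − r^p` (real powers). -/
noncomputable def hfun (p r t : ℝ) : ℝ := (r + max t 0) ^ p - r ^ p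

/-- `H_p(r,t) = (1/(p+1))·[(r + t⁺)^{p+1} − r^{p+1} − (p+1)·r^p·t⁺]` (real powers). -/
noncomputable def Hfun (p r t : ℝ) : ℝ :=
  (1 / (p + 1)) * ((r + max t 0) ^ (p + 1) - r ^ (p + 1) - (p + 1) * r ^ p * max t 0)

/-- for `p > 1`, `θ ∈ (2, p+1)` and `M > 0` there is `T > 0` such that
`H_p(r,t) ≤ (1/θ)·h_p(r,t)·t` whenever `0 ≤ r ≤ M` and `t ≥ T`. -/
theorem stmt_11 (p : ℝ) (hp : 1 < p) (θ : ℝ) (hθ2 : 2 < θ) (hθp : θ < p + 1)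
    (M : ℝ) (hM : 0 < M) :
    ∃ T : ℝ, 0 < T ∧ ∀ r : ℝ, 0 ≤ r → r ≤ M → ∀ t : ℝ, T ≤ t →
      Hfun p r t ≤ (1 / θ) * hfun p r t * t := by
  have hd : 0 < p + 1 - θ := by linarith
  have hθ : 0 < θ := by linarith
  have hp1 : 0 < p + 1 := by linarith
  have hT : 0 < θ * M / (p + 1 - θ) := by positivity
  refine ⟨θ * M / (p + 1 - θ), hT, fun r hr hrM t ht => ?_⟩
  have ht0 : 0 < t := hT.trans_le ht
  have hrt : θ * r ≤ (p + 1 - θ) * t := by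
    rw [div_le_iff₀ hd] at ht
    nlinarith
  unfold Hfun hfun
  rw [max_eq_left ht0.le, Real.rpow_add_one' (by positivity) hp1.ne',
    Real.rpow_add_one' hr hp1.ne']
  have hA : 0 ≤ (r + t) ^ p := by positivity
  have hR : 0 ≤ r ^ p := by positivity
  generalize (r + t) ^ p = A at hA ⊢
  generalize r ^ p = R at hR ⊢
  have hAr : A * (θ * r) ≤ A * ((p + 1 - θ) * t) := mul_le_mul_of_nonneg_left hrt hA
  have hRt : 0 ≤ (p + 1) * (θ - 1) * (R * t) :=
    mul_nonneg (mul_nonneg hp1.le (by linarith)) (by positivity)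
  have hRr : 0 ≤ θ * (R * r) := by positivity
  rw [one_div_mul_eq_div, one_div_mul_eq_div, div_mul_eq_mul_div, div_le_div_iff₀ hp1 hθ]
  linarith
end

section
/- Let p > 1 be real. For every ε > 0 there exists c_ε > 0 such that H_p(r,t) − (p/2)·r^{p−1}·t² ≤ ε·r^{p−1}·t² + c_ε·t^{p+1} for all real r, t ≥ 0. -/
theorem le_of_hasDerivAt_nonneg {f f' : ℝ → ℝ} {t : ℝ} (ht : 0 ≤ t)
    (hf : ∀ x, HasDerivAt f (f' x) x) (hf' : ∀ x, 0 ≤ x → x ≤ t → 0 ≤ f' x) :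
    f 0 ≤ f t := by
  have hmono : MonotoneOn f (Set.Icc 0 t) := by
    refine monotoneOn_of_deriv_nonneg (convex_Icc 0 t)
      (fun x _ => (hf x).continuousAt.continuousWithinAt)
      (fun x _ => (hf x).differentiableAt.differentiableWithinAt) (fun x hx => ?_)
    rw [interior_Icc] at hx
    rw [(hf x).deriv]
    exact hf' x hx.1.le hx.2.le
  exact hmono ⟨le_rfl, ht⟩ ⟨ht, le_rfl⟩ ht

theorem hasDerivAt_const_add_rpow {s : ℝ} (hs : 1 ≤ s) (r x : ℝ) :
    HasDerivAt (fun x => (r + x) ^ s) (s * (r + x) ^ (s - 1)) x := by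
  have h := ((hasDerivAt_id x).const_add r).rpow_const (p := s) (Or.inr hs)
  simpa using h

theorem rpow_add_sub_rpow_le {p r t : ℝ} (hp : 1 < p) (hr : 0 ≤ r) (ht : 0 ≤ t) :
    (r + t) ^ p - r ^ p ≤ p * (r + t) ^ (p - 1) * t := by
  have h := le_of_hasDerivAt_nonneg
    (f := fun x => p * (r + t) ^ (p - 1) * x - (r + x) ^ p)
    (f' := fun x => p * (r + t) ^ (p - 1) * 1 - p * (r + x) ^ (p - 1)) ht
    (fun x => ((hasDerivAt_id x).const_mul _).sub (hasDerivAt_const_add_rpow hp.le r x))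
    (fun x hx hxt => by
      have h1 : (r + x) ^ (p - 1) ≤ (r + t) ^ (p - 1) :=
        Real.rpow_le_rpow (by linarith) (by linarith) (by linarith)
      have h2 := mul_le_mul_of_nonneg_left h1 (by linarith : 0 ≤ p)
      linarith)
  simp only [add_zero, mul_zero] at h
  linarith

theorem Hfun_le {p r t : ℝ} (hp : 1 < p) (hr : 0 ≤ r) (ht : 0 ≤ t) :
    Hfun p r t ≤ p / 2 * (r + t) ^ (p - 1) * t ^ 2 := by
  have h := le_of_hasDerivAt_nonneg
    (f := fun x => (p + 1) * (p / 2 * (r + t) ^ (p - 1)) * x ^ 2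
      + (p + 1) * r ^ p * x - (r + x) ^ (p + 1))
    (f' := fun x => (p + 1) * (p / 2 * (r + t) ^ (p - 1)) * (2 * x)
      + (p + 1) * r ^ p * 1 - (p + 1) * (r + x) ^ p) ht
    (fun x => by
      have h1 := hasDerivAt_const_add_rpow (by linarith : 1 ≤ p + 1) r x
      rw [add_sub_cancel_right] at h1
      have h2 : HasDerivAt (fun x : ℝ => x ^ 2) (2 * x) x := by
        simpa using hasDerivAt_pow 2 x
      exact ((h2.const_mul _).add ((hasDerivAt_id x).const_mul _)).sub h1)
    (fun x hx hxt => by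
      have h1 : (r + x) ^ (p - 1) ≤ (r + t) ^ (p - 1) :=
        Real.rpow_le_rpow (by linarith) (by linarith) (by linarith)
      have h2 : p * (r + x) ^ (p - 1) * x ≤ p * (r + t) ^ (p - 1) * x := by gcongr
      have h3 := rpow_add_sub_rpow_le hp hr hx
      have h4 := mul_nonneg (by linarith : 0 ≤ p + 1)
        (by linarith : 0 ≤ p * (r + t) ^ (p - 1) * x + r ^ p - (r + x) ^ p)
      linarith)
  simp only [add_zero, mul_zero, ne_eq, OfNat.ofNat_ne_zero, not_false_eq_true, zero_pow] at h
  have hp1 : 0 < p + 1 := by linarith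
  rw [Hfun, max_eq_left ht, one_div, inv_mul_le_iff₀ hp1]
  linarith

theorem exists_add_rpow_le {q δ : ℝ} (hq : 0 < q) (hδ : 0 < δ) :
    ∃ C : ℝ, 0 < C ∧ ∀ r t : ℝ, 0 ≤ r → 0 ≤ t →
      (r + t) ^ q ≤ (1 + δ) * r ^ q + C * t ^ q := by
  set a := (1 + δ) ^ q⁻¹ with ha
  have ha1 : 1 < a := Real.one_lt_rpow (by linarith) (inv_pos.mpr hq)
  have haq : a ^ q = 1 + δ := Real.rpow_inv_rpow (by linarith) hq.ne'
  have hs : 0 < a - 1 := by linarith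
  have hb : 0 < (a - 1)⁻¹ + 1 := by positivity
  refine ⟨((a - 1)⁻¹ + 1) ^ q, Real.rpow_pos_of_pos hb q, fun r t hr ht => ?_⟩
  have hrq := Real.rpow_nonneg hr q
  have htq := Real.rpow_nonneg ht q
  rcases le_total t ((a - 1) * r) with h | h
  · have h1 : (r + t) ^ q ≤ (a * r) ^ q :=
      Real.rpow_le_rpow (by linarith) (by linarith) hq.le
    rw [Real.mul_rpow (by linarith) hr, haq] at h1
    have : 0 ≤ ((a - 1)⁻¹ + 1) ^ q * t ^ q := by positivity
    linarith
  · have h0 : r ≤ (a - 1)⁻¹ * t := (le_inv_mul_iff₀ hs).mpr h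
    have h1 : (r + t) ^ q ≤ (((a - 1)⁻¹ + 1) * t) ^ q :=
      Real.rpow_le_rpow (by linarith) (by linarith) hq.le
    rw [Real.mul_rpow hb.le ht] at h1
    have : 0 ≤ (1 + δ) * r ^ q := by positivity
    linarith

/-- for `p > 1` and every `ε > 0` there is `c_ε > 0` with
`H_p(r,t) − (p/2)·r^{p−1}·t² ≤ ε·r^{p−1}·t² + c_ε·t^{p+1}` for all `r, t ≥ 0`. -/
theorem stmt_13 (p : ℝ) (hp : 1 < p) :
    ∀ ε : ℝ, 0 < ε → ∃ c : ℝ, 0 < c ∧ ∀ r t : ℝ, 0 ≤ r → 0 ≤ t →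
      Hfun p r t - (p / 2) * r ^ (p - 1) * t ^ 2 ≤
        ε * r ^ (p - 1) * t ^ 2 + c * t ^ (p + 1) := by
  intro ε hε
  have hp0 : 0 < p := by linarith
  obtain ⟨C, hC, h⟩ := exists_add_rpow_le (q := p - 1) (δ := 2 * ε / p)
    (by linarith) (by positivity)
  refine ⟨p / 2 * C, by positivity, fun r t hr ht => ?_⟩
  have ht2 : t ^ (p + 1) = t ^ (p - 1) * t ^ 2 := by
    rw [← Real.rpow_natCast t 2, ← Real.rpow_add_of_nonneg ht (by linarith) (by norm_num)]
    congr 1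
    push_cast
    ring
  have h1 : p / 2 * (r + t) ^ (p - 1) * t ^ 2
      ≤ p / 2 * ((1 + 2 * ε / p) * r ^ (p - 1) + C * t ^ (p - 1)) * t ^ 2 := by
    gcongr
    exact h r t hr ht
  have h2 : p / 2 * ((1 + 2 * ε / p) * r ^ (p - 1) + C * t ^ (p - 1)) * t ^ 2
      = p / 2 * r ^ (p - 1) * t ^ 2 + ε * r ^ (p - 1) * t ^ 2
        + p / 2 * C * (t ^ (p - 1) * t ^ 2) := by
    field_simp
  rw [ht2]
  linarith [Hfun_le hp hr ht]
end
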